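/- arXiv:2605.18817 — 2 statements merged into one kernel-verified Lean document; each statement's English description precedes it below -/
import Mathlib

section
/- Let L, d, V be positive natural numbers, let f be a function from embedding matrices (functions from Fin L to ℝ^d) to logit matrices (functions from Fin L to ℝ^V) that is Lipschitz with constant κ/L with respect to the Frobenius (entrywise ℓ2) norms on input and output, and let κ ≥ 0. Let E and E' be two embedding matrices that agree on every row outside a nonempty finite set R ⊆ Fin L. Then for every position i ∉ R, the total variation distance between softmax((f E') i) and softmax((f E) i) is at most κ · (|R| / L) · max_{j ∈ R} ‖E' j − E j‖₂. -/
/-- Softmax of a vector of logits. -/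
noncomputable def softmax {V : ℕ} (x : Fin V → ℝ) : Fin V → ℝ :=
  fun i => Real.exp (x i) / ∑ j, Real.exp (x j)

/-- Total variation distance between two vectors, `(1/2) · ∑ i |p i − q i|`. -/
noncomputable def tvDist {V : ℕ} (p q : Fin V → ℝ) : ℝ :=
  (1 / 2) * ∑ i, |p i - q i|

/-- Euclidean (ℓ2) norm of a vector. -/
noncomputable def l2norm {d : ℕ} (v : Fin d → ℝ) : ℝ :=
  Real.sqrt (∑ k, (v k) ^ 2)

/-- Frobenius (entrywise ℓ2) norm of a matrix. -/
noncomputable def frobNorm {L d : ℕ} (M : Fin L → Fin d → ℝ) : ℝ :=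
  Real.sqrt (∑ j, ∑ k, (M j k) ^ 2)

/-- Softmax is `1`-Lipschitz from the sup norm to total variation distance. -/
lemma tvDist_softmax_le {V : ℕ} (hV : 0 < V) (x y : Fin V → ℝ) (M : ℝ)
    (h : ∀ k, |y k - x k| ≤ M) : tvDist (softmax y) (softmax x) ≤ M := by
  classical
  have hne : (Finset.univ : Finset (Fin V)).Nonempty := ⟨⟨0, hV⟩, Finset.mem_univ _⟩
  have hM : 0 ≤ M := (abs_nonneg _).trans (h ⟨0, hV⟩)
  have hexp : ∀ s t : ℝ, |s - t| ≤ M → Real.exp s - Real.exp t ≤ M * Real.exp s := by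
    intro s t hst
    have h1 := Real.add_one_le_exp (t - s)
    have h2 : Real.exp t = Real.exp s * Real.exp (t - s) := by
      rw [← Real.exp_add]; ring_nf
    have h3 := (abs_le.mp hst).2
    rw [h2]
    nlinarith [Real.exp_pos s]
  have hsum : ∀ z : Fin V → ℝ, ∑ k, softmax z k = 1 := by
    intro z
    simp only [softmax]
    rw [← Finset.sum_div]
    exact div_self (Finset.sum_pos (fun k _ => Real.exp_pos _) hne).ne'
  set A : Finset (Fin V) := Finset.univ.filter (fun k => softmax x k ≤ softmax y k) with hA
  have htv : tvDist (softmax y) (softmax x) = ∑ k ∈ A, softmax y k - ∑ k ∈ A, softmax x k := by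
    have h1 := Finset.sum_add_sum_compl A (softmax y)
    have h2 := Finset.sum_add_sum_compl A (softmax x)
    have h3 := Finset.sum_add_sum_compl A (fun k => |softmax y k - softmax x k|)
    have h4 : ∑ k ∈ A, |softmax y k - softmax x k| = ∑ k ∈ A, (softmax y k - softmax x k) :=
      Finset.sum_congr rfl fun k hk => abs_of_nonneg (by simp [hA] at hk; linarith)
    have h5 : ∑ k ∈ Aᶜ, |softmax y k - softmax x k| = ∑ k ∈ Aᶜ, (softmax x k - softmax y k) :=
      Finset.sum_congr rfl fun k hk => by
        rw [abs_of_nonpos (by simp [hA] at hk; linarith), neg_sub]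
    rw [hsum] at h1 h2
    rw [h4, h5, Finset.sum_sub_distrib, Finset.sum_sub_distrib] at h3
    unfold tvDist
    linarith
  rw [htv]
  simp only [softmax]
  rw [← Finset.sum_div, ← Finset.sum_div,
    ← Finset.sum_add_sum_compl A (fun k => Real.exp (y k)),
    ← Finset.sum_add_sum_compl A (fun k => Real.exp (x k))]
  have hy : 0 < ∑ k ∈ A, Real.exp (y k) + ∑ k ∈ Aᶜ, Real.exp (y k) := by
    rw [Finset.sum_add_sum_compl]
    exact Finset.sum_pos (fun k _ => Real.exp_pos _) hne
  have hx : 0 < ∑ k ∈ A, Real.exp (x k) + ∑ k ∈ Aᶜ, Real.exp (x k) := by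
    rw [Finset.sum_add_sum_compl]
    exact Finset.sum_pos (fun k _ => Real.exp_pos _) hne
  have ha : ∑ k ∈ A, Real.exp (y k) - ∑ k ∈ A, Real.exp (x k) ≤ M * ∑ k ∈ A, Real.exp (y k) := by
    rw [← Finset.sum_sub_distrib, Finset.mul_sum]
    exact Finset.sum_le_sum fun k _ => hexp _ _ (h k)
  have hb : ∑ k ∈ Aᶜ, Real.exp (x k) - ∑ k ∈ Aᶜ, Real.exp (y k)
      ≤ M * ∑ k ∈ Aᶜ, Real.exp (x k) := by
    rw [← Finset.sum_sub_distrib, Finset.mul_sum]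
    exact Finset.sum_le_sum fun k _ => hexp _ _ (by rw [abs_sub_comm]; exact h k)
  have pos : ∀ (B : Finset (Fin V)) (z : Fin V → ℝ), 0 ≤ ∑ k ∈ B, Real.exp (z k) :=
    fun B z => Finset.sum_nonneg fun k _ => (Real.exp_pos _).le
  have p1 := pos A y
  have p2 := pos A x
  have p3 := pos Aᶜ y
  have p4 := pos Aᶜ x
  generalize ∑ k ∈ A, Real.exp (y k) = a' at *
  generalize ∑ k ∈ A, Real.exp (x k) = a at *
  generalize ∑ k ∈ Aᶜ, Real.exp (y k) = b' at *
  generalize ∑ k ∈ Aᶜ, Real.exp (x k) = b at *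
  rw [div_sub_div _ _ hy.ne' hx.ne', div_le_iff₀ (mul_pos hy hx)]
  have hu := mul_nonneg p1 p4
  have hv := mul_nonneg p2 p3
  rcases le_total 1 M with h1 | h1
  · nlinarith [mul_nonneg p1 p2, mul_nonneg p3 p4,
      mul_nonneg (sub_nonneg.mpr h1) (mul_nonneg hy.le hx.le)]
  · have hM1 : 0 ≤ 1 - M := by linarith
    have huv : (1 - M) ^ 2 * (a' * b) ≤ a * b' := by
      have := mul_le_mul (show (1 - M) * a' ≤ a by linarith) (show (1 - M) * b ≤ b' by linarith)
        (mul_nonneg hM1 p4) p2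
      linarith
    obtain ⟨s, hs, hsu⟩ : ∃ s : ℝ, 0 ≤ s ∧ s ^ 2 = a' * b :=
      ⟨√(a' * b), Real.sqrt_nonneg _, Real.sq_sqrt hu⟩
    obtain ⟨w, hw, hwv⟩ : ∃ w : ℝ, 0 ≤ w ∧ w ^ 2 = a * b' :=
      ⟨√(a * b'), Real.sqrt_nonneg _, Real.sq_sqrt hv⟩
    have hsw : (1 - M) * s ≤ w := by
      refine (pow_le_pow_iff_left₀ (mul_nonneg hM1 hs) hw two_ne_zero).mp ?_
      rw [mul_pow, hsu, hwv]
      exact huv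
    have hamgm : 2 * (s * w) ≤ a * a' + b * b' := by
      refine (pow_le_pow_iff_left₀ (by positivity) (by positivity) two_ne_zero).mp ?_
      have : (2 * (s * w)) ^ 2 = 4 * ((a' * b) * (a * b')) := by rw [← hsu, ← hwv]; ring
      rw [this]
      nlinarith [sq_nonneg (a * a' - b * b')]
    have hfac : s - w ≤ M * (s + w) := by nlinarith [mul_nonneg hM hw]
    have hmul := mul_le_mul_of_nonneg_right hfac (add_nonneg hs hw)
    have hslack := mul_le_mul_of_nonneg_left hamgm hM
    linear_combination hmul + hslack + (M - 1) * hsu + (M + 1) * hwv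

/-- A matrix supported on the rows in `R` has Frobenius norm at most `|R|` times any bound
on the norms of these rows. -/
lemma frobNorm_le_card_mul {L d : ℕ} (M : Fin L → Fin d → ℝ) (R : Finset (Fin L)) (S : ℝ)
    (hS : 0 ≤ S) (hout : ∀ j ∉ R, M j = 0) (hin : ∀ j ∈ R, l2norm (M j) ≤ S) :
    frobNorm M ≤ R.card * S := by
  unfold frobNorm
  refine Real.sqrt_le_iff.mpr ⟨by positivity, ?_⟩
  have h1 : ∑ j, ∑ k, (M j k) ^ 2 = ∑ j ∈ R, ∑ k, (M j k) ^ 2 :=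
    (Finset.sum_subset (Finset.subset_univ R) fun j _ hj => by simp [hout j hj]).symm
  have h2 : ∑ j ∈ R, ∑ k, (M j k) ^ 2 ≤ R.card * S ^ 2 := by
    rw [← nsmul_eq_mul]
    exact Finset.sum_le_card_nsmul _ _ _ fun j hj => (Real.sqrt_le_left hS).mp (hin j hj)
  have h3 : (R.card : ℝ) ≤ (R.card : ℝ) ^ 2 := by
    exact_mod_cast Nat.le_self_pow two_ne_zero _
  rw [h1, mul_pow]
  exact h2.trans (mul_le_mul_of_nonneg_right h3 (sq_nonneg S))

lemma abs_le_frobNorm {L d : ℕ} (M : Fin L → Fin d → ℝ) (i : Fin L) (k : Fin d) :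
    |M i k| ≤ frobNorm M := by
  unfold frobNorm
  refine Real.abs_le_sqrt ?_
  calc (M i k) ^ 2 ≤ ∑ k, (M i k) ^ 2 :=
        Finset.single_le_sum (f := fun k => (M i k) ^ 2) (fun _ _ => sq_nonneg _)
          (Finset.mem_univ k)
    _ ≤ _ := Finset.single_le_sum (f := fun j => ∑ k, (M j k) ^ 2)
          (fun _ _ => Finset.sum_nonneg fun _ _ => sq_nonneg _) (Finset.mem_univ i)

/-- Proposition 1 (one-step contraction): if `f` is `κ/L`-Lipschitz in the Frobenius
norms and `E`, `E'` agree outside the nonempty set `R`, then for every position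
`i ∉ R` the total variation distance between the softmaxed output rows is at most
`κ · (|R|/L) · max_{j ∈ R} ‖E' j − E j‖₂`. -/
theorem one_step_contraction {L d V : ℕ} (hL : 0 < L) (hd : 0 < d) (hV : 0 < V)
    (κ : ℝ) (hκ : 0 ≤ κ)
    (f : (Fin L → Fin d → ℝ) → (Fin L → Fin V → ℝ))
    (hf : ∀ A B : Fin L → Fin d → ℝ,
      frobNorm (fun j k => f B j k - f A j k) ≤ (κ / L) * frobNorm (fun j k => B j k - A j k))
    (E E' : Fin L → Fin d → ℝ) (R : Finset (Fin L)) (hR : R.Nonempty)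
    (hagree : ∀ j ∉ R, E' j = E j)
    (i : Fin L) (hi : i ∉ R) :
    tvDist (softmax (f E' i)) (softmax (f E i)) ≤
      κ * ((R.card : ℝ) / L) * R.sup' hR (fun j => l2norm (fun k => E' j k - E j k)) := by
  set S := R.sup' hR (fun j => l2norm (fun k => E' j k - E j k))
  have hin : ∀ j ∈ R, l2norm (fun k => E' j k - E j k) ≤ S := fun j hj =>
    Finset.le_sup' (fun j => l2norm (fun k => E' j k - E j k)) hj
  have hS : 0 ≤ S := by
    obtain ⟨j, hj⟩ := hR
    exact (Real.sqrt_nonneg _).trans (hin j hj)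
  have hfrob : frobNorm (fun j k => E' j k - E j k) ≤ R.card * S :=
    frobNorm_le_card_mul (fun j k => E' j k - E j k) R S hS (fun j hj => by
      ext k
      simp [hagree j hj]) hin
  refine tvDist_softmax_le hV _ _ _ fun k => ?_
  calc |f E' i k - f E i k| ≤ frobNorm (fun j k => f E' j k - f E j k) :=
        abs_le_frobNorm (fun j k => f E' j k - f E j k) i k
    _ ≤ κ / L * frobNorm (fun j k => E' j k - E j k) := hf E E'
    _ ≤ κ / L * (R.card * S) := by gcongr
    _ = κ * ((R.card : ℝ) / L) * S := by ring
end

section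
/- Let L, d, V be positive natural numbers, let f be a function from embedding matrices (functions from Fin L to ℝ^d) to logit matrices (functions from Fin L to ℝ^V) that is Lipschitz with constant κ/L with respect to the Frobenius (entrywise ℓ2) norms, with κ ≥ 0. Let E and E' be two embedding matrices agreeing on every row outside a nonempty finite set R ⊆ Fin L. Then for every position i ∈ Fin L, the total variation distance between softmax((f E') i) and softmax((f E) i) is at most (κ / (2L)) · √|R| · max_{j ∈ R} ‖E' j − E j‖₂. -/
/-- Cauchy–Schwarz for a weighted mean: the weighted mean absolute deviation of `v`, with
nonnegative weights `w`, is at most the Euclidean norm of `v` (written without divisions). -/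
theorem sum_mul_abs_sub_le_l2norm {V : ℕ} (w v : Fin V → ℝ) (hw : ∀ i, 0 ≤ w i) :
    ∑ i, w i * |v i * ∑ j, w j - ∑ j, w j * v j| ≤ (∑ j, w j) ^ 2 * l2norm v := by
  set Z := ∑ j, w j with hZ
  set M := ∑ j, w j * v j with hM
  have hZ0 : 0 ≤ Z := Finset.sum_nonneg fun i _ => hw i
  have cauchy : (∑ i, w i * |v i * Z - M|) ^ 2 ≤ Z * ∑ i, w i * (v i * Z - M) ^ 2 := by
    refine Finset.sum_sq_le_sum_mul_sum_of_sq_le_mul _ (fun i _ => hw i)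
      (fun i _ => mul_nonneg (hw i) (sq_nonneg _)) fun i _ => ?_
    rw [mul_pow, sq_abs]
    exact le_of_eq (by ring)
  have expand : ∑ i, w i * (v i * Z - M) ^ 2 = Z ^ 2 * ∑ i, w i * v i ^ 2 - Z * M ^ 2 := by
    have : ∀ i, w i * (v i * Z - M) ^ 2
        = Z ^ 2 * (w i * v i ^ 2) - 2 * Z * M * (w i * v i) + M ^ 2 * w i := fun i => by ring
    simp only [this, Finset.sum_add_distrib, Finset.sum_sub_distrib, ← Finset.mul_sum]
    rw [← hM, ← hZ]
    ring
  have moment : ∑ i, w i * v i ^ 2 ≤ Z * ∑ i, v i ^ 2 := by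
    rw [Finset.mul_sum]
    exact Finset.sum_le_sum fun i _ => mul_le_mul_of_nonneg_right
      (Finset.single_le_sum (fun j _ => hw j) (Finset.mem_univ i)) (sq_nonneg _)
  refine le_of_sq_le_sq ?_ (mul_nonneg (sq_nonneg _) (Real.sqrt_nonneg _))
  calc (∑ i, w i * |v i * Z - M|) ^ 2 ≤ Z * (Z ^ 2 * ∑ i, w i * v i ^ 2 - Z * M ^ 2) :=
        expand ▸ cauchy
    _ ≤ Z * (Z ^ 2 * (Z * ∑ i, v i ^ 2)) := by
        gcongr
        nlinarith [mul_le_mul_of_nonneg_left moment (sq_nonneg Z), mul_nonneg hZ0 (sq_nonneg M)]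
    _ = (Z ^ 2 * l2norm v) ^ 2 := by
        rw [mul_pow, l2norm, Real.sq_sqrt (Finset.sum_nonneg fun i _ => sq_nonneg (v i))]
        ring

/-- The derivative of a coordinate of softmax along a line. -/
theorem hasDerivAt_softmax_line {V : ℕ} (x v : Fin V → ℝ) (i : Fin V) (t : ℝ) :
    HasDerivAt (fun s : ℝ => softmax (fun j => x j + s * v j) i)
      (Real.exp (x i + t * v i) *
        (v i * ∑ j, Real.exp (x j + t * v j) - ∑ j, Real.exp (x j + t * v j) * v j) /
        (∑ j, Real.exp (x j + t * v j)) ^ 2) t := by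
  have hexp : ∀ j, HasDerivAt (fun s : ℝ => Real.exp (x j + s * v j))
      (Real.exp (x j + t * v j) * v j) t := fun j => by
    simpa using (((hasDerivAt_id t).mul_const (v j)).const_add (x j)).exp
  have hsum : HasDerivAt (fun s : ℝ => ∑ j, Real.exp (x j + s * v j))
      (∑ j, Real.exp (x j + t * v j) * v j) t := HasDerivAt.fun_sum fun j _ => hexp j
  have hpos : 0 < ∑ j, Real.exp (x j + t * v j) :=
    Finset.sum_pos (fun j _ => Real.exp_pos _) ⟨i, Finset.mem_univ i⟩
  refine ((hexp i).fun_div hsum hpos.ne').congr_deriv ?_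
  ring

/-- Softmax is `1/2`-Lipschitz from the Euclidean norm to total variation distance. -/
theorem tvDist_softmax_le_s1 {V : ℕ} (x y : Fin V → ℝ) :
    tvDist (softmax y) (softmax x) ≤ 1 / 2 * l2norm (fun k => y k - x k) := by
  set v : Fin V → ℝ := fun k => y k - x k with hv
  rw [tvDist]
  gcongr
  rcases isEmpty_or_nonempty (Fin V) with hV | hV
  · simp [l2norm]
  let σ : Fin V → ℝ := fun i => SignType.sign (softmax y i - softmax x i)
  have hσ : ∀ i, |σ i| ≤ 1 := fun i => by
    rcases lt_trichotomy (softmax y i - softmax x i) 0 with h | h | h <;> simp [σ, h]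
  let g : ℝ → ℝ := fun t => ∑ i, σ i * softmax (fun j => x j + t * v j) i
  have hg := fun t : ℝ => HasDerivAt.fun_sum fun (i : Fin V) (_ : i ∈ Finset.univ) =>
    (hasDerivAt_softmax_line x v i t).const_mul (σ i)
  obtain ⟨t, -, ht⟩ := exists_hasDerivAt_eq_slope g _ zero_lt_one
    (fun t _ => (hg t).continuousAt.continuousWithinAt) (fun t _ => hg t)
  have hdiff : ∑ i, |softmax y i - softmax x i| = (g 1 - g 0) / (1 - 0) := by
    simp only [g, hv, sub_zero, div_one, one_mul, zero_mul, add_zero, add_sub_cancel,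
      ← Finset.sum_sub_distrib, ← mul_sub, σ, sign_mul_self]
  have hpos : 0 < ∑ j, Real.exp (x j + t * v j) :=
    Finset.sum_pos (fun j _ => Real.exp_pos _) Finset.univ_nonempty
  rw [hdiff, ← ht]
  simp only [← mul_div_assoc, ← Finset.sum_div]
  rw [div_le_iff₀ (by positivity), mul_comm (l2norm v)]
  refine le_trans (Finset.sum_le_sum fun i _ => ?_)
    (sum_mul_abs_sub_le_l2norm (fun j => Real.exp (x j + t * v j)) v fun j => (Real.exp_pos _).le)
  refine (le_abs_self _).trans ?_
  rw [abs_mul, abs_mul, abs_of_pos (Real.exp_pos _)]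
  exact mul_le_of_le_one_left (by positivity) (hσ i)

theorem l2norm_row_le_frobNorm {L d : ℕ} (M : Fin L → Fin d → ℝ) (i : Fin L) :
    l2norm (M i) ≤ frobNorm M :=
  Real.sqrt_le_sqrt <| Finset.single_le_sum (f := fun j => ∑ k, M j k ^ 2)
    (fun _ _ => Finset.sum_nonneg fun _ _ => sq_nonneg _) (Finset.mem_univ i)

/-- A matrix supported on the rows in `R` has Frobenius norm at most `√|R|` times the largest
row norm. -/
theorem frobNorm_le_sqrt_card_mul_sup' {L d : ℕ} (M : Fin L → Fin d → ℝ) (R : Finset (Fin L))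
    (hR : R.Nonempty) (hM : ∀ j ∉ R, M j = 0) :
    frobNorm M ≤ Real.sqrt (R.card : ℝ) * R.sup' hR (fun j => l2norm (M j)) := by
  set S := R.sup' hR (fun j => l2norm (M j))
  have hrow : ∀ j ∈ R, l2norm (M j) ≤ S := fun j hj =>
    Finset.le_sup' (fun j => l2norm (M j)) hj
  obtain ⟨j₀, hj₀⟩ := hR
  have hS : 0 ≤ S := (Real.sqrt_nonneg _).trans (hrow j₀ hj₀)
  have hsq : ∑ j, ∑ k, M j k ^ 2 ≤ R.card * S ^ 2 := by
    rw [← Finset.sum_subset (Finset.subset_univ R) fun j _ hj => by simp [hM j hj],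
      ← nsmul_eq_mul]
    exact Finset.sum_le_card_nsmul _ _ _ fun j hj => (Real.sqrt_le_left hS).1 (hrow j hj)
  calc frobNorm M ≤ Real.sqrt (R.card * S ^ 2) := Real.sqrt_le_sqrt hsq
    _ = Real.sqrt R.card * S := by rw [Real.sqrt_mul (Nat.cast_nonneg _), Real.sqrt_sq hS]

/-- Sharp intermediate form of Proposition 1: for every position `i`,
the total variation distance between the softmaxed output rows is at most
`(κ/(2L)) · √|R| · max_{j ∈ R} ‖E' j − E j‖₂`. -/
theorem one_step_contraction_sharp {L d V : ℕ} (hL : 0 < L) (hd : 0 < d) (hV : 0 < V)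
    (κ : ℝ) (hκ : 0 ≤ κ)
    (f : (Fin L → Fin d → ℝ) → (Fin L → Fin V → ℝ))
    (hf : ∀ A B : Fin L → Fin d → ℝ,
      frobNorm (fun j k => f B j k - f A j k) ≤ (κ / L) * frobNorm (fun j k => B j k - A j k))
    (E E' : Fin L → Fin d → ℝ) (R : Finset (Fin L)) (hR : R.Nonempty)
    (hagree : ∀ j ∉ R, E' j = E j)
    (i : Fin L) :
    tvDist (softmax (f E' i)) (softmax (f E i)) ≤
      (κ / (2 * L)) * Real.sqrt (R.card : ℝ) *
        R.sup' hR (fun j => l2norm (fun k => E' j k - E j k)) := by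
  calc tvDist (softmax (f E' i)) (softmax (f E i))
      ≤ 1 / 2 * l2norm (fun k => f E' i k - f E i k) := tvDist_softmax_le_s1 _ _
    _ ≤ 1 / 2 * ((κ / L) * (Real.sqrt (R.card : ℝ) *
        R.sup' hR (fun j => l2norm (fun k => E' j k - E j k)))) := by
        gcongr
        refine (l2norm_row_le_frobNorm (fun j k => f E' j k - f E j k) i).trans
          ((hf E E').trans ?_)
        gcongr
        exact frobNorm_le_sqrt_card_mul_sup' (fun j k => E' j k - E j k) R hR fun j hj => by
          simp only [hagree j hj, sub_self]
          rfl
    _ = _ := by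
        field_simp
end
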